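/- For every ε > 0 there exists a constant C > 0 such that for every real B ≥ 1, the number of quadruples (n_1, n_2, n_3, n_4) of nonzero squareful integers satisfying |n_i| ≤ B for each i ∈ {1,2,3,4} and n_1 + n_2 = n_3 + n_4 is at most C·B^{1+ε}. -/

import Mathlib

/-- An integer `a` is squareful if `p^2 ∣ a` for every prime `p` dividing `a`. -/
def Squareful (a : ℤ) : Prop := ∀ p : ℕ, p.Prime → (p : ℤ) ∣ a → (p : ℤ)^2 ∣ a

open Finset

/-- The divisor bound: `d(n) ≪ n ^ δ` for every `δ > 0`. -/
lemma exists_card_divisors_le_rpow {δ : ℝ} (hδ : 0 < δ) :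
    ∃ C : ℝ, 0 < C ∧ ∀ n : ℕ, n ≠ 0 → (#n.divisors : ℝ) ≤ C * (n : ℝ) ^ δ := by
  have hlog : 0 < Real.log 2 := Real.log_pos (by norm_num)
  set c : ℝ := δ * Real.log 2 with hc
  have hc0 : 0 < c := by positivity
  set K : ℝ := 1 + 1 / c with hK
  have hK1 : 1 ≤ K := le_add_of_nonneg_right (by positivity)
  set Q : ℕ := ⌈(2 : ℝ) ^ (1 / δ)⌉₊
  have key : ∀ p e : ℕ, p.Prime →
      ((e : ℝ) + 1) ≤ (if p < Q then K else 1) * ((p : ℝ) ^ e) ^ δ := by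
    intro p e hp
    have hp2 : (2 : ℝ) ≤ p := by exact_mod_cast hp.two_le
    have hcomm : ((p : ℝ) ^ e) ^ δ = ((p : ℝ) ^ δ) ^ e := by
      rw [← Real.rpow_natCast, ← Real.rpow_mul (by positivity), mul_comm,
        Real.rpow_mul (by positivity), Real.rpow_natCast]
    split_ifs with h
    · have h1 : 1 + (e : ℝ) * c ≤ ((p : ℝ) ^ e) ^ δ := by
        calc 1 + (e : ℝ) * c ≤ Real.exp (e * c) := by
              linarith [Real.add_one_le_exp ((e : ℝ) * c)]
          _ = ((2 : ℝ) ^ e) ^ δ := by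
              rw [← Real.rpow_natCast, ← Real.rpow_mul (by norm_num),
                Real.rpow_def_of_pos (by norm_num)]
              congr 1; rw [hc]; ring
          _ ≤ _ := by gcongr
      calc (e : ℝ) + 1 ≤ K * (1 + e * c) := by
            have : K * (1 + e * c) = 1 + e + (1 / c + e * c) := by rw [hK]; field_simp; ring
            have : 0 ≤ 1 / c + e * c := by positivity
            linarith
        _ ≤ _ := by gcongr
    · have h2 : (2 : ℝ) ≤ (p : ℝ) ^ δ := by
        have : (2 : ℝ) ^ (1 / δ) ≤ p := (Nat.le_ceil _).trans (by exact_mod_cast not_lt.mp h)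
        calc (2 : ℝ) = ((2 : ℝ) ^ (1 / δ)) ^ δ := by
              rw [← Real.rpow_mul (by norm_num), one_div_mul_cancel hδ.ne', Real.rpow_one]
          _ ≤ _ := by gcongr
      rw [one_mul, hcomm]
      calc (e : ℝ) + 1 ≤ 2 ^ e := by exact_mod_cast Nat.lt_two_pow_self
        _ ≤ _ := by gcongr
  refine ⟨K ^ Q, by positivity, fun n hn => ?_⟩
  rw [Nat.card_divisors hn]
  push_cast
  calc ∏ p ∈ n.primeFactors, ((n.factorization p : ℝ) + 1)
      ≤ ∏ p ∈ n.primeFactors, (if p < Q then K else 1) * ((p : ℝ) ^ n.factorization p) ^ δ :=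
        prod_le_prod (fun _ _ => by positivity)
          fun p hp => key p _ (Nat.prime_of_mem_primeFactors hp)
    _ = K ^ #(n.primeFactors.filter (· < Q)) * (n : ℝ) ^ δ := by
        rw [prod_mul_distrib, Real.finsetProd_rpow _ _ (fun _ _ => by positivity), prod_ite]
        congr 2
        · simp
        · conv_rhs => rw [← Nat.prod_factorization_pow_eq_self hn]
          rw [Finsupp.prod]; push_cast; rfl
    _ ≤ _ := by
        gcongr 1
        refine pow_le_pow_right₀ hK1 ?_
        calc _ ≤ #(range Q) := card_le_card fun p hp => by simp at hp ⊢; exact hp.2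
          _ = Q := card_range Q

lemma Squareful.exists_eq_pow_mul_sq {n : ℤ} (hn : n ≠ 0) (h : Squareful n) :
    ∃ y x : ℤ, y ≠ 0 ∧ 0 < x ∧ n = y ^ 3 * x ^ 2 := by
  obtain ⟨a, b, hab, ha⟩ := Nat.sq_mul_squarefree n.natAbs
  have hm : n.natAbs ≠ 0 := by simpa
  have hdvd : a ∣ b := by
    rw [← Nat.prod_primeFactors_of_squarefree ha]
    refine Finset.prod_primes_dvd b (fun p hp => (Nat.prime_of_mem_primeFactors hp).prime) ?_
    intro p hp
    have hpp := Nat.prime_of_mem_primeFactors hp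
    have hpa := Nat.dvd_of_mem_primeFactors hp
    by_contra hpb
    have hpn : p ^ 2 ∣ n.natAbs := by
      have := h p hpp (Int.natCast_dvd.mpr (hab ▸ hpa.mul_left _))
      exact Int.natCast_dvd.mp (by exact_mod_cast this)
    rw [← hab] at hpn
    have hcop : Nat.Coprime (p ^ 2) (b ^ 2) :=
      Nat.Coprime.pow 2 2 ((Nat.Prime.coprime_iff_not_dvd hpp).mpr hpb)
    have := ha p (by rw [← sq]; exact hcop.dvd_of_dvd_mul_left hpn)
    exact hpp.one_lt.ne' (Nat.isUnit_iff.mp this)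
  obtain ⟨c, rfl⟩ := hdvd
  have ha0 : a ≠ 0 := ha.ne_zero
  have hc0 : c ≠ 0 := by rintro rfl; simp at hab; exact hn (by omega)
  have habs : |n| = (a : ℤ) ^ 3 * (c : ℤ) ^ 2 := by
    rw [Int.abs_eq_natAbs, ← hab]; push_cast; ring
  rcases abs_choice n with h1 | h1
  · exact ⟨a, c, by exact_mod_cast ha0, by omega, by rw [← habs, h1]⟩
  · exact ⟨-a, c, by simpa using ha0, by omega, by
      rw [Odd.neg_pow (by decide), neg_mul, ← habs, h1, neg_neg]⟩

lemma sum_comp_le_mul_sum {α β : Type*} [DecidableEq β] {S : Finset α} {T : Finset β} {π : α → β}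
    {f : β → ℝ} {K : ℕ} (hf : ∀ b ∈ T, 0 ≤ f b) (hπ : ∀ a ∈ S, π a ∈ T)
    (hK : ∀ b ∈ T, #{a ∈ S | π a = b} ≤ K) :
    ∑ a ∈ S, f (π a) ≤ K * ∑ b ∈ T, f b := by
  rw [← sum_fiberwise_of_maps_to hπ, mul_sum]
  refine sum_le_sum fun b hb => ?_
  rw [sum_congr rfl (g := fun _ => f b) fun a ha => by rw [(mem_filter.mp ha).2], sum_const,
    nsmul_eq_mul]
  gcongr
  · exact hf b hb
  · exact hK b hb

lemma card_filter_product_eq_sum_sq {α β : Type*} [DecidableEq β] {s : Finset α} {g : α → β}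
    {M : Finset β} (hM : ∀ a ∈ s, g a ∈ M) :
    #{z ∈ s ×ˢ s | g z.1 = g z.2} = ∑ m ∈ M, #{a ∈ s | g a = m} ^ 2 := by
  rw [card_eq_sum_card_fiberwise (f := fun z => g z.1) (t := M)]
  · refine sum_congr rfl fun m _ => ?_
    rw [sq, ← card_product]
    congr 1
    ext ⟨a, b⟩
    simp only [mem_filter, mem_product]
    grind
  · intro z hz
    simp only [coe_filter, mem_product, Set.mem_ofPred_eq] at hz
    exact hM _ hz.1.1

/-- Cauchy–Schwarz for collisions of `g` on a set coloured by `c`. -/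
lemma card_collisions_le {α β ι : Type*} [DecidableEq β] [DecidableEq ι] {s : Finset α} {g : α → β}
    {c : α → ι} {C : Finset ι} {w : ι → ℝ} (hw : ∀ i ∈ C, 0 < w i) (hc : ∀ a ∈ s, c a ∈ C) :
    (#{z ∈ s ×ˢ s | g z.1 = g z.2} : ℝ) ≤ (∑ i ∈ C, (w i)⁻¹) *
      ∑ z ∈ s ×ˢ s with g z.1 = g z.2 ∧ c z.1 = c z.2, w (c z.1) := by
  have hM : ∀ a ∈ s, g a ∈ s.image g := fun a ha => mem_image_of_mem g ha
  rw [card_filter_product_eq_sum_sq hM]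
  have h1 : ∑ z ∈ s ×ˢ s with g z.1 = g z.2 ∧ c z.1 = c z.2, w (c z.1) =
      ∑ m ∈ s.image g, ∑ i ∈ C, w i * (#{a ∈ s | g a = m ∧ c a = i} : ℝ) ^ 2 := by
    rw [sum_comm, ← sum_fiberwise_of_maps_to (g := fun z => c z.1) (t := C)]
    · refine sum_congr rfl fun i _ => ?_
      rw [sum_congr rfl (g := fun _ => w i) fun a ha => by rw [(mem_filter.mp ha).2], sum_const,
        nsmul_eq_mul, ← mul_sum, mul_comm]
      congr 1
      have := card_filter_product_eq_sum_sq (s := {a ∈ s | c a = i}) (g := g) (M := s.image g)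
        fun a ha => hM a (mem_filter.mp ha).1
      simp only [filter_filter, and_comm] at this ⊢
      rw [← Nat.cast_inj (R := ℝ)] at this
      push_cast at this
      rw [← this]
      congr 2
      ext ⟨a, b⟩
      simp only [mem_filter, mem_product]
      grind
    · intro z hz
      exact hc _ (mem_product.mp (mem_filter.mp hz).1).1
  rw [h1, mul_sum]
  push_cast
  refine sum_le_sum fun m _ => ?_
  have h2 : (#{a ∈ s | g a = m} : ℝ) = ∑ i ∈ C, (#{a ∈ s | g a = m ∧ c a = i} : ℝ) := by
    rw [card_eq_sum_card_fiberwise (f := c) (t := C)]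
    · push_cast
      simp only [filter_filter]
    · intro a ha
      exact hc a (mem_filter.mp ha).1
  rw [h2]
  refine sum_sq_le_sum_mul_sum_of_sq_le_mul C (fun i hi => (inv_pos.mpr (hw i hi)).le)
    (fun i hi => mul_nonneg (hw i hi).le (sq_nonneg _)) fun i hi => ?_
  exact (inv_mul_cancel_left₀ (hw i hi).ne' _).ge

/-- The integer divisors of `D`, of both signs. -/
noncomputable def intDivisors (D : ℤ) : Finset ℤ := {d ∈ Icc (-|D|) |D| | d ∣ D}

lemma mem_intDivisors {d D : ℤ} (hD : D ≠ 0) : d ∈ intDivisors D ↔ d ∣ D := by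
  simp only [intDivisors, mem_filter, mem_Icc, and_iff_right_iff_imp, ← abs_le]
  exact fun h => Int.le_of_dvd (abs_pos.mpr hD) ((abs_dvd_abs _ _).mpr h)

lemma card_filter_natAbs_eq_le (s : Finset ℤ) (n : ℕ) : #{d ∈ s | d.natAbs = n} ≤ 2 :=
  (card_le_card (t := {(n : ℤ), -(n : ℤ)}) fun d hd => by
    simp only [mem_filter, mem_insert, mem_singleton] at hd ⊢; omega).trans card_le_two

lemma card_intDivisors_le {D : ℤ} (hD : D ≠ 0) : #(intDivisors D) ≤ 2 * #D.natAbs.divisors :=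
  card_le_mul_card_image_of_maps_to (f := Int.natAbs) (fun d hd => by
    rw [mem_intDivisors hD] at hd
    simpa [hD] using Int.natAbs_dvd_natAbs.mpr hd) 2 fun n _ => card_filter_natAbs_eq_le _ n


/-- Pairs `(y, x)` with `y ≠ 0`, `x > 0` and `|y ^ 3 * x ^ 2| ≤ N`. -/
noncomputable def squarefulPairs (N : ℕ) : Finset (ℤ × ℤ) :=
  {p ∈ ((Icc (-N : ℤ) N).erase 0) ×ˢ Icc (1 : ℤ) N | |p.1| ^ 3 * p.2 ^ 2 ≤ N}

/-- The squareful integer `y ^ 3 * x ^ 2` attached to a pair `(y, x)`. -/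
def pairVal (p : ℤ × ℤ) : ℤ := p.1 ^ 3 * p.2 ^ 2

lemma abs_pairVal (p : ℤ × ℤ) : |pairVal p| = |p.1| ^ 3 * p.2 ^ 2 := by
  rw [pairVal, abs_mul, abs_pow, abs_pow, sq_abs]

lemma mem_squarefulPairs {N : ℕ} {p : ℤ × ℤ} :
    p ∈ squarefulPairs N ↔ p.1 ≠ 0 ∧ 0 < p.2 ∧ |pairVal p| ≤ N := by
  rw [abs_pairVal]
  simp only [squarefulPairs, mem_filter, mem_product, mem_erase, mem_Icc]
  refine ⟨fun h => ⟨h.1.1.1, by omega, h.2⟩, fun ⟨h1, h2, h3⟩ => ?_⟩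
  have h4 : 1 ≤ |p.1| := Int.one_le_abs h1
  have h5 : 1 ≤ |p.1| ^ 3 := one_le_pow₀ h4
  have h6 : 1 ≤ p.2 ^ 2 := one_le_pow₀ (by omega)
  have h7 : |p.1| ≤ |p.1| ^ 3 := le_self_pow₀ h4 (by norm_num)
  have h8 : p.2 ≤ p.2 ^ 2 := le_self_pow₀ (by omega) (by norm_num)
  have h9 : |p.1| ≤ N := by nlinarith
  exact ⟨⟨⟨h1, abs_le.mp h9⟩, by omega, by nlinarith⟩, h3⟩

lemma pairVal_ne_zero {N : ℕ} {p : ℤ × ℤ} (hp : p ∈ squarefulPairs N) : pairVal p ≠ 0 := by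
  obtain ⟨h1, h2, -⟩ := mem_squarefulPairs.mp hp
  exact mul_ne_zero (pow_ne_zero _ h1) (pow_ne_zero _ h2.ne')

lemma eq_of_fst_eq_of_pairVal_eq {N : ℕ} {p q : ℤ × ℤ} (hp : p ∈ squarefulPairs N)
    (hq : q ∈ squarefulPairs N) (h1 : p.1 = q.1) (h : pairVal p = pairVal q) : p = q := by
  obtain ⟨hp1, hp2, -⟩ := mem_squarefulPairs.mp hp
  obtain ⟨-, hq2, -⟩ := mem_squarefulPairs.mp hq
  rw [pairVal, pairVal, ← h1] at h
  exact Prod.ext h1 ((sq_eq_sq₀ hp2.le hq2.le).mp (mul_left_cancel₀ (pow_ne_zero _ hp1) h))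

lemma sum_inv_abs_le (N : ℕ) :
    ∑ y ∈ (Icc (-N : ℤ) N).erase 0, (|y| : ℝ)⁻¹ ≤ 2 * (harmonic N : ℝ) := by
  rw [harmonic_eq_sum_Icc]
  push_cast
  have := sum_comp_le_mul_sum (S := (Icc (-N : ℤ) N).erase 0) (T := Icc 1 N) (π := Int.natAbs)
    (f := fun n => (n : ℝ)⁻¹) (K := 2) (fun _ _ => by positivity)
    (fun a ha => by simp only [mem_erase, mem_Icc] at ha ⊢; omega)
    fun n _ => card_filter_natAbs_eq_le _ n
  simpa [Nat.cast_natAbs] using this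

lemma sum_sqrt_abs_fst_le (N : ℕ) :
    ∑ p ∈ squarefulPairs N, √|(p.1 : ℝ)| ≤ 2 * (harmonic N : ℝ) * √N := by
  rw [← sum_fiberwise_of_maps_to (g := Prod.fst) (t := (Icc (-N : ℤ) N).erase 0)]
  · calc _ ≤ ∑ y ∈ (Icc (-N : ℤ) N).erase 0, (|y| : ℝ)⁻¹ * √N := ?_
      _ ≤ _ := by rw [← sum_mul]; gcongr; exact sum_inv_abs_le N
    refine sum_le_sum fun y hy => ?_
    rw [sum_congr rfl (g := fun _ => √|(y : ℝ)|) fun a ha => by rw [(mem_filter.mp ha).2],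
      sum_const, nsmul_eq_mul]
    have hy0 : 0 < |(y : ℝ)| := by simpa using (mem_erase.mp hy).1
    have hcard : (#{p ∈ squarefulPairs N | p.1 = y} : ℝ) ≤ √(N / |(y : ℝ)| ^ 3) := by
      have : #{p ∈ squarefulPairs N | p.1 = y} ≤ #(Icc 1 ⌊√(N / |(y : ℝ)| ^ 3)⌋₊) := by
        refine card_le_card_of_injOn (fun p => p.2.natAbs) (fun p hp => ?_) fun p hp q hq h => ?_
        · simp only [coe_filter, Set.mem_ofPred_eq] at hp
          obtain ⟨hp, rfl⟩ := hp
          obtain ⟨-, h2, h3⟩ := mem_squarefulPairs.mp hp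
          rw [abs_pairVal] at h3
          have h3' : |(p.1 : ℝ)| ^ 3 * (p.2 : ℝ) ^ 2 ≤ N := by exact_mod_cast h3
          simp only [coe_Icc, Set.mem_Icc]
          refine ⟨by omega, Nat.le_floor (Real.le_sqrt_of_sq_le ?_)⟩
          rw [le_div_iff₀ (by positivity), Nat.cast_natAbs, Int.cast_abs, sq_abs, mul_comm]
          exact h3'
        · simp only [coe_filter, Set.mem_ofPred_eq] at hp hq
          obtain ⟨hp, hp1⟩ := hp
          obtain ⟨hq, hq1⟩ := hq
          have hp2 := (mem_squarefulPairs.mp hp).2.1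
          have hq2 := (mem_squarefulPairs.mp hq).2.1
          exact Prod.ext (hp1.trans hq1.symm) (by simp only at h; omega)
      calc _ ≤ (#(Icc 1 ⌊√(N / |(y : ℝ)| ^ 3)⌋₊) : ℝ) := by exact_mod_cast this
        _ ≤ _ := by rw [Nat.card_Icc, Nat.add_sub_cancel]; exact Nat.floor_le (Real.sqrt_nonneg _)
    calc _ ≤ √(N / |(y : ℝ)| ^ 3) * √|(y : ℝ)| := by gcongr
      _ = √((|(y : ℝ)|⁻¹) ^ 2 * N) := by
        rw [← Real.sqrt_mul (by positivity)]; congr 1; field_simp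
      _ = _ := by rw [Real.sqrt_mul (by positivity), Real.sqrt_sq (by positivity)]
  · intro p hp
    exact (mem_product.mp (mem_filter.mp hp).1).1

/-- Pairs of pairs whose second member has the smaller first coordinate. -/
noncomputable def orderedPairs (N : ℕ) : Finset ((ℤ × ℤ) × (ℤ × ℤ)) :=
  {a ∈ squarefulPairs N ×ˢ squarefulPairs N | |a.2.1| ≤ |a.1.1|}

lemma mem_orderedPairs {N : ℕ} {a : (ℤ × ℤ) × (ℤ × ℤ)} : a ∈ orderedPairs N ↔
    (a.1 ∈ squarefulPairs N ∧ a.2 ∈ squarefulPairs N) ∧ |a.2.1| ≤ |a.1.1| := by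
  rw [orderedPairs, mem_filter, mem_product]

/-- The sum of the two squareful integers attached to a pair of pairs. -/
def pairSum (a : (ℤ × ℤ) × (ℤ × ℤ)) : ℤ := pairVal a.1 + pairVal a.2

lemma card_energy_le_four_mul (N : ℕ) :
    #{z ∈ (squarefulPairs N ×ˢ squarefulPairs N) ×ˢ (squarefulPairs N ×ˢ squarefulPairs N) |
      pairSum z.1 = pairSum z.2} ≤
    4 * #{z ∈ orderedPairs N ×ˢ orderedPairs N | pairSum z.1 = pairSum z.2} := by
  set t := squarefulPairs N ×ˢ squarefulPairs N with ht
  have hM : ∀ a ∈ t, pairSum a ∈ t.image pairSum := fun a ha => mem_image_of_mem _ ha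
  have hM' : ∀ a ∈ orderedPairs N, pairSum a ∈ t.image pairSum :=
    fun a ha => hM a (mem_filter.mp ha).1
  rw [card_filter_product_eq_sum_sq hM, card_filter_product_eq_sum_sq hM', mul_sum]
  refine sum_le_sum fun m _ => ?_
  have : #{a ∈ t | pairSum a = m} ≤ 2 * #{a ∈ orderedPairs N | pairSum a = m} := by
    calc _ ≤ #({a ∈ orderedPairs N | pairSum a = m} ∪
          {a ∈ orderedPairs N | pairSum a = m}.image Prod.swap) := by
          refine card_le_card fun a ha => ?_
          simp only [ht, mem_filter, mem_product, mem_union, mem_image, mem_orderedPairs] at ha ⊢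
          rcases le_total |a.2.1| |a.1.1| with h | h
          · exact Or.inl ⟨⟨ha.1, h⟩, ha.2⟩
          · refine Or.inr ⟨a.swap, ⟨⟨ha.1.symm, h⟩, ?_⟩, rfl⟩
            rw [← ha.2, pairSum, pairSum]
            exact add_comm _ _
      _ ≤ #{a ∈ orderedPairs N | pairSum a = m} +
          #({a ∈ orderedPairs N | pairSum a = m}.image Prod.swap) := card_union_le _ _
      _ ≤ _ := by rw [two_mul]; exact Nat.add_le_add_left card_image_le _
  nlinarith

lemma abs_le_sqrt_mul_sqrt {a b c : ℝ} (hb : |a| ≤ |b|) (hc : |a| ≤ |c|) :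
    |a| ≤ √|b| * √|c| := by
  rw [← Real.sqrt_mul (abs_nonneg b)]
  refine Real.le_sqrt_of_sq_le ?_
  nlinarith [abs_nonneg a]

lemma sum_ordered_le {N T : ℕ} (hT : ∀ n ≠ 0, n ≤ 2 * N → #n.divisors ≤ T) :
    ∑ z ∈ orderedPairs N ×ˢ orderedPairs N with
      pairSum z.1 = pairSum z.2 ∧ z.1.2.1 = z.2.2.1, |(z.1.2.1 : ℝ)| ≤
    (2 * T + (2 * T) ^ 3) * (∑ p ∈ squarefulPairs N, √|(p.1 : ℝ)|) ^ 2 := by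
  have hdiv : ∀ D : ℤ, D ≠ 0 → |D| ≤ 2 * N → #(intDivisors D) ≤ 2 * T := fun D hD h =>
    (card_intDivisors_le hD).trans (by
      gcongr
      exact hT _ (by simpa) (by rw [Int.abs_eq_natAbs] at h; omega))
  set P := squarefulPairs N
  have hW : (∑ p ∈ P, √|(p.1 : ℝ)|) ^ 2 =
      ∑ a ∈ P ×ˢ P, √|(a.1.1 : ℝ)| * √|(a.2.1 : ℝ)| := by
    rw [sq, sum_mul_sum, sum_product]
  have hcast : ∀ {a b : ℤ}, |a| ≤ |b| → |(a : ℝ)| ≤ |(b : ℝ)| := fun h => by exact_mod_cast h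
  rw [← sum_filter_add_sum_filter_not _ (fun z => pairVal z.1.1 = pairVal z.2.1), add_mul, hW]
  refine add_le_add ?_ ?_
  · calc _ ≤ ∑ z ∈ {z ∈ {z ∈ orderedPairs N ×ˢ orderedPairs N |
            pairSum z.1 = pairSum z.2 ∧ z.1.2.1 = z.2.2.1} | pairVal z.1.1 = pairVal z.2.1},
            √|(z.1.1.1 : ℝ)| * √|(z.1.2.1 : ℝ)| := by
          refine sum_le_sum fun z hz => ?_
          simp only [mem_filter, mem_product, mem_orderedPairs] at hz
          exact abs_le_sqrt_mul_sqrt (hcast hz.1.1.1.2) le_rfl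
      _ ≤ (2 * T : ℕ) * ∑ a ∈ P ×ˢ P, √|(a.1.1 : ℝ)| * √|(a.2.1 : ℝ)| := by
          refine sum_comp_le_mul_sum (π := Prod.fst)
            (f := fun a : (ℤ × ℤ) × (ℤ × ℤ) => √|(a.1.1 : ℝ)| * √|(a.2.1 : ℝ)|)
            (fun _ _ => by positivity) ?_ ?_
          · intro z hz
            simp only [mem_filter, mem_product, mem_orderedPairs] at hz ⊢
            exact hz.1.1.1.1
          · intro b hb
            have hb1 := (mem_product.mp hb).1
            have hb0 := pairVal_ne_zero hb1
            refine le_trans (card_le_card_of_injOn (t := intDivisors (pairVal b.1))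
              (fun z => z.2.1.1) ?_ ?_) (hdiv _ hb0 ?_)
            · intro z hz
              simp only [coe_filter, mem_filter, mem_product, mem_orderedPairs,
                Set.mem_ofPred_eq] at hz
              obtain ⟨hz, rfl⟩ := hz
              rw [mem_coe, mem_intDivisors hb0, hz.2]
              exact (dvd_pow_self _ three_ne_zero).mul_right _
            · rintro ⟨a, p, q⟩ hz ⟨a', p', q'⟩ hz' h
              simp only [coe_filter, mem_filter, mem_product, mem_orderedPairs,
                Set.mem_ofPred_eq] at hz hz' h
              simp only [pairSum] at hz hz'
              obtain ⟨hz, rfl⟩ := hz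
              obtain ⟨hz', rfl⟩ := hz'
              have e1 : p = p' := eq_of_fst_eq_of_pairVal_eq hz.1.1.2.1.1 hz'.1.1.2.1.1 h
                (hz.2.symm.trans hz'.2)
              have e2 : q = q' := eq_of_fst_eq_of_pairVal_eq hz.1.1.2.1.2 hz'.1.1.2.1.2
                (hz.1.2.2.symm.trans hz'.1.2.2)
                (by have := hz.1.2.1; have := hz'.1.2.1; have := hz.2; have := hz'.2; omega)
              rw [e1, e2]
            · have := (mem_squarefulPairs.mp hb1).2.2
              omega
      _ = _ := by push_cast; rfl
  · calc _ ≤ ∑ z ∈ {z ∈ {z ∈ orderedPairs N ×ˢ orderedPairs N |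
            pairSum z.1 = pairSum z.2 ∧ z.1.2.1 = z.2.2.1} | ¬ pairVal z.1.1 = pairVal z.2.1},
            √|(z.1.1.1 : ℝ)| * √|(z.2.1.1 : ℝ)| := by
          refine sum_le_sum fun z hz => ?_
          simp only [mem_filter, mem_product, mem_orderedPairs] at hz
          refine abs_le_sqrt_mul_sqrt (hcast hz.1.1.1.2) (hcast ?_)
          rw [hz.1.2.2]
          exact hz.1.1.2.2
      _ ≤ ((2 * T) ^ 3 : ℕ) * ∑ a ∈ P ×ˢ P, √|(a.1.1 : ℝ)| * √|(a.2.1 : ℝ)| := by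
          refine sum_comp_le_mul_sum
            (π := fun z : ((ℤ × ℤ) × (ℤ × ℤ)) × ((ℤ × ℤ) × (ℤ × ℤ)) => (z.1.1, z.2.1))
            (f := fun a : (ℤ × ℤ) × (ℤ × ℤ) => √|(a.1.1 : ℝ)| * √|(a.2.1 : ℝ)|)
            (fun _ _ => by positivity) ?_ ?_
          · intro z hz
            simp only [mem_filter, mem_product, mem_orderedPairs] at hz ⊢
            exact ⟨hz.1.1.1.1.1, hz.1.1.2.1.1⟩
          · rintro ⟨p, p'⟩ hb
            obtain ⟨hp, hp'⟩ := mem_product.mp hb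
            by_cases hD : pairVal p - pairVal p' = 0
            · refine (card_eq_zero.mpr (filter_eq_empty_iff.mpr ?_)).le.trans (Nat.zero_le _)
              rintro ⟨⟨a, b⟩, c, d⟩ hz h
              simp only [mem_filter, Prod.mk.injEq] at hz h
              obtain ⟨rfl, rfl⟩ := h
              exact hz.2 (by omega)
            set I := intDivisors (pairVal p - pairVal p') with hI
            refine le_trans (card_le_card_of_injOn (t := I ×ˢ I ×ˢ I)
              (fun z => (z.1.2.1, z.2.2.2 - z.1.2.2, z.2.2.2 + z.1.2.2)) ?_ ?_) ?_
            · rintro ⟨⟨a, ⟨y, x⟩⟩, b, ⟨y', x'⟩⟩ hz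
              simp only [coe_filter, mem_filter, mem_product, mem_orderedPairs,
                Set.mem_ofPred_eq, Prod.mk.injEq] at hz
              simp only [pairSum] at hz
              obtain ⟨⟨⟨-, hz, rfl⟩, -⟩, rfl, rfl⟩ := hz
              have hfac : pairVal a - pairVal b = y ^ 3 * ((x' - x) * (x' + x)) := by
                have : pairVal a - pairVal b = pairVal (y, x') - pairVal (y, x) := by omega
                rw [this, pairVal, pairVal]; ring
              simp only [mem_coe, mem_product, hI, mem_intDivisors hD]
              rw [hfac]
              exact ⟨(dvd_pow_self _ three_ne_zero).mul_right _,
                (dvd_mul_right _ _).mul_left _, (dvd_mul_left _ _).mul_left _⟩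
            · rintro ⟨⟨a, ⟨y, x⟩⟩, b, ⟨y', x'⟩⟩ hz ⟨⟨c, ⟨u, v⟩⟩, d, ⟨u', v'⟩⟩ hz' h
              simp only [coe_filter, mem_filter, mem_product, mem_orderedPairs,
                Set.mem_ofPred_eq, Prod.mk.injEq] at hz hz' h
              obtain ⟨hz, rfl, rfl⟩ := hz
              obtain ⟨hz', rfl, rfl⟩ := hz'
              have e1 := hz.1.2.2
              have e2 := hz'.1.2.2
              simp only [Prod.mk.injEq, true_and]
              omega
            · have hc : #I ≤ 2 * T := by
                refine hdiv _ hD ((abs_sub _ _).trans ?_)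
                have h1 := (mem_squarefulPairs.mp hp).2.2
                have h2 := (mem_squarefulPairs.mp hp').2.2
                simp only at h1 h2
                omega
              rw [card_product, card_product, pow_three]
              gcongr
      _ = _ := by push_cast; rfl

lemma card_energy_le {N T : ℕ} (hT : ∀ n ≠ 0, n ≤ 2 * N → #n.divisors ≤ T) :
    (#{z ∈ (squarefulPairs N ×ˢ squarefulPairs N) ×ˢ (squarefulPairs N ×ˢ squarefulPairs N) |
      pairSum z.1 = pairSum z.2} : ℝ) ≤
    32 * (2 * T + (2 * T) ^ 3) * (harmonic N : ℝ) ^ 3 * N := by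
  have hH : (0 : ℝ) ≤ harmonic N := by
    rw [harmonic]; push_cast; positivity
  calc _ ≤ 4 * (#{z ∈ orderedPairs N ×ˢ orderedPairs N | pairSum z.1 = pairSum z.2} : ℝ) := by
        exact_mod_cast card_energy_le_four_mul N
    _ ≤ 4 * ((2 * harmonic N) *
        ((2 * T + (2 * T) ^ 3) * (2 * (harmonic N : ℝ) * √N) ^ 2)) := by
        gcongr
        refine (card_collisions_le (c := fun a => a.2.1) (C := (Icc (-N : ℤ) N).erase 0)
          (w := fun y => |(y : ℝ)|) (fun y hy => ?_) fun a ha => ?_).trans ?_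
        · simpa using (mem_erase.mp hy).1
        · exact (mem_product.mp (mem_filter.mp (mem_orderedPairs.mp ha).1.2).1).1
        · refine mul_le_mul (sum_inv_abs_le N) ((sum_ordered_le hT).trans ?_)
            (sum_nonneg fun _ _ => abs_nonneg _) (by positivity)
          gcongr
          exact sum_sqrt_abs_fst_le N
    _ = _ := by rw [mul_pow _ (√(N : ℝ)), Real.sq_sqrt (by positivity)]; ring

lemma ncard_quadruples_le (B : ℝ) :
    Set.ncard {q : Fin 4 → ℤ |
        (∀ i, q i ≠ 0 ∧ Squareful (q i) ∧ (|q i| : ℝ) ≤ B) ∧ q 0 + q 1 = q 2 + q 3} ≤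
    #{z ∈ (squarefulPairs ⌊B⌋₊ ×ˢ squarefulPairs ⌊B⌋₊) ×ˢ
        (squarefulPairs ⌊B⌋₊ ×ˢ squarefulPairs ⌊B⌋₊) | pairSum z.1 = pairSum z.2} := by
  rw [← Set.ncard_coe_finset]
  refine (Set.ncard_le_ncard (t := (fun z : ((ℤ × ℤ) × (ℤ × ℤ)) × ((ℤ × ℤ) × (ℤ × ℤ)) =>
    ![pairVal z.1.1, pairVal z.1.2, pairVal z.2.1, pairVal z.2.2]) '' _) ?_
    ((finite_toSet _).image _)).trans (Set.ncard_image_le (finite_toSet _))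
  rintro q ⟨h, hq⟩
  have key : ∀ i, ∃ p ∈ squarefulPairs ⌊B⌋₊, pairVal p = q i := by
    intro i
    obtain ⟨h0, h1, h2⟩ := h i
    obtain ⟨y, x, hy, hx, hyx⟩ := h1.exists_eq_pow_mul_sq h0
    refine ⟨(y, x), mem_squarefulPairs.mpr ⟨hy, hx, ?_⟩, hyx.symm⟩
    have : pairVal (y, x) = q i := hyx.symm
    rw [this, Int.abs_eq_natAbs, Nat.cast_le]
    refine Nat.le_floor ?_
    rwa [Nat.cast_natAbs, Int.cast_abs]
  choose p hp hpq using key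
  refine ⟨((p 0, p 1), (p 2, p 3)), ?_, ?_⟩
  · refine mem_coe.mpr (mem_filter.mpr ⟨?_, ?_⟩)
    · simp only [mem_product]
      exact ⟨⟨hp 0, hp 1⟩, hp 2, hp 3⟩
    · simpa only [pairSum, hpq] using hq
  · ext i
    fin_cases i <;> simp [hpq]

theorem squareful_quadruples_bound (ε : ℝ) (hε : 0 < ε) :
    ∃ C > (0:ℝ), ∀ B : ℝ, 1 ≤ B →
      (Set.ncard {q : Fin 4 → ℤ |
          (∀ i, q i ≠ 0 ∧ Squareful (q i) ∧ (|q i| : ℝ) ≤ B) ∧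
          q 0 + q 1 = q 2 + q 3} : ℝ) ≤ C * B ^ (1 + ε) := by
  set δ : ℝ := ε / 6 with hδ
  have hδ0 : 0 < δ := by positivity
  obtain ⟨K, hK, hd⟩ := exists_card_divisors_le_rpow hδ0
  set L : ℝ := 1 + K * 2 ^ δ with hL
  have hL1 : 1 ≤ L := by rw [hL]; linarith [show 0 ≤ K * (2 : ℝ) ^ δ by positivity]
  refine ⟨32 * (2 * L + (2 * L) ^ 3) * (1 + 1 / δ) ^ 3, by positivity, fun B hB => ?_⟩
  set N := ⌊B⌋₊
  have hB0 : 0 < B := by linarith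
  have hNB : (N : ℝ) ≤ B := Nat.floor_le hB0.le
  have hN1 : 1 ≤ N := (Nat.one_le_floor_iff _).mpr hB
  have hBδ : 1 ≤ B ^ δ := Real.one_le_rpow hB hδ0.le
  set T := ⌊L * B ^ δ⌋₊
  have hTL : (T : ℝ) ≤ L * B ^ δ := Nat.floor_le (by positivity)
  have hT : ∀ n ≠ 0, n ≤ 2 * N → #n.divisors ≤ T := by
    intro n hn hnN
    refine Nat.le_floor ((hd n hn).trans ?_)
    have : (n : ℝ) ≤ 2 * B := by
      have : (n : ℝ) ≤ 2 * N := by exact_mod_cast hnN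
      linarith
    calc K * (n : ℝ) ^ δ ≤ K * (2 * B) ^ δ := by gcongr
      _ = K * 2 ^ δ * B ^ δ := by rw [Real.mul_rpow (by norm_num) hB0.le]; ring
      _ ≤ _ := by gcongr; linarith
  have hH0 : (0 : ℝ) ≤ harmonic N := by rw [harmonic]; push_cast; positivity
  have hH : (harmonic N : ℝ) ≤ (1 + 1 / δ) * B ^ δ := by
    calc (harmonic N : ℝ) ≤ 1 + Real.log N := harmonic_le_one_add_log N
      _ ≤ 1 + Real.log B := by
        gcongr
      _ ≤ B ^ δ + B ^ δ / δ := by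
        gcongr
        exact Real.log_le_rpow_div hB0.le hδ0
      _ = _ := by ring
  have hT3 : (2 * T + (2 * T) ^ 3 : ℝ) ≤ (2 * L + (2 * L) ^ 3) * (B ^ δ) ^ 3 := by
    have h1 : B ^ δ ≤ (B ^ δ) ^ 3 := le_self_pow₀ hBδ (by norm_num)
    calc (2 * T + (2 * T) ^ 3 : ℝ) ≤ 2 * (L * B ^ δ) + (2 * (L * B ^ δ)) ^ 3 := by gcongr
      _ = 2 * L * B ^ δ + (2 * L) ^ 3 * (B ^ δ) ^ 3 := by ring
      _ ≤ 2 * L * (B ^ δ) ^ 3 + (2 * L) ^ 3 * (B ^ δ) ^ 3 := by gcongr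
      _ = _ := by ring
  calc _ ≤ 32 * (2 * T + (2 * T) ^ 3) * (harmonic N : ℝ) ^ 3 * N :=
        (Nat.cast_le.mpr (ncard_quadruples_le B)).trans (card_energy_le hT)
    _ ≤ 32 * ((2 * L + (2 * L) ^ 3) * (B ^ δ) ^ 3) * ((1 + 1 / δ) * B ^ δ) ^ 3 * B := by gcongr
    _ = 32 * (2 * L + (2 * L) ^ 3) * (1 + 1 / δ) ^ 3 * (B * (B ^ δ) ^ 6) := by ring
    _ = _ := by
      have : (B ^ δ) ^ 6 = B ^ ε := by
        rw [← Real.rpow_natCast, ← Real.rpow_mul hB0.le, hδ]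
        congr 1
        push_cast; ring
      rw [Real.rpow_add hB0, Real.rpow_one, this]
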